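/- Let (K,d) be a based complex over a field whose digraph G_K is finite, and let μ be a Morse matching on G_K. With d̃, δ = d − d̃, f̃, g̃, h̃ as defined from μ, and S = Σ_{n≥0} δ(h̃δ)^n, define K^{(μ)} to be the chain complex with chain groups ⊕_{α∈I_n∩μ⁰} K^α and differential d^μ = f̃ S g̃. Then setting f = f̃ + f̃Sh̃, g = g̃ + h̃Sg̃, and h = h̃ + h̃Sh̃, the triple (f, g, h) is a contraction from (K,d) onto (K^{(μ)}, d^μ). -/

import Mathlib

open LinearMap Submodule

/-! ## Gradings of vector spaces -/

/-- An internal grading of a vector space `V` by an index type `ι`, given by a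
system of orthogonal idempotent projections which sum (pointwise, with finite
support) to the identity.  The graded piece at `i` is the range of `proj i`. -/
structure VGrading (k V ι : Type*) [Field k] [AddCommGroup V] [Module k V] where
  proj : ι → V →ₗ[k] V
  proj_idem : ∀ i, proj i ∘ₗ proj i = proj i
  proj_orth : ∀ i j, i ≠ j → proj i ∘ₗ proj j = 0
  proj_finite : ∀ v : V, (Function.support fun i => proj i v).Finite
  proj_total : ∀ v : V, (∑ᶠ i, proj i v) = v

namespace VGrading

variable {k V ι : Type*} [Field k] [AddCommGroup V] [Module k V]

/-- The graded piece of a grading at index `i`. -/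
def piece (G : VGrading k V ι) (i : ι) : Submodule k V := LinearMap.range (G.proj i)

end VGrading

/-- The `(i,j)` component of a linear map between `ι`-graded vector spaces:
include the `j`-th piece, apply `f`, project to the `i`-th piece. -/
def gcomp {k V W ι : Type*} [Field k] [AddCommGroup V] [Module k V]
    [AddCommGroup W] [Module k W]
    (GW : VGrading k W ι) (GV : VGrading k V ι) (f : V →ₗ[k] W) (i j : ι) :
    V →ₗ[k] W :=
  GW.proj i ∘ₗ (f ∘ₗ GV.proj j)

/-! ## Contractions and perturbations -/

/-- A contraction `(f, g, h)` from the differential `dC` on `V` onto the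
differential `dD` on `W`: `f, g` are chain maps, `f ∘ g = 1`,
`g ∘ f = 1 + dC h + h dC`, and the side conditions `f h = 0`, `h g = 0`,
`h h = 0` hold. -/
structure IsContraction {k V W : Type*} [Field k] [AddCommGroup V] [Module k V]
    [AddCommGroup W] [Module k W]
    (dC : V →ₗ[k] V) (dD : W →ₗ[k] W)
    (f : V →ₗ[k] W) (g : W →ₗ[k] V) (h : V →ₗ[k] V) : Prop where
  f_chain : f ∘ₗ dC = dD ∘ₗ f
  g_chain : g ∘ₗ dD = dC ∘ₗ g
  fg : f ∘ₗ g = LinearMap.id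
  gf : g ∘ₗ f = LinearMap.id + dC ∘ₗ h + h ∘ₗ dC
  fh : f ∘ₗ h = 0
  hg : h ∘ₗ g = 0
  hh : h ∘ₗ h = 0

/-- Iterated composition of an endomorphism. -/
def endPow {k V : Type*} [Field k] [AddCommGroup V] [Module k V]
    (f : V →ₗ[k] V) : ℕ → (V →ₗ[k] V)
  | 0 => LinearMap.id
  | n + 1 => f ∘ₗ endPow f n

/-- `S` is the sum `Σ_{n ≥ 0} δ (h δ)^n`, which is well defined whenever
`h δ` is locally nilpotent: on every vector the series is eventually zero and
`S` is given by the corresponding finite partial sum. -/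
def IsPerturbSum {k V : Type*} [Field k] [AddCommGroup V] [Module k V]
    (δ h S : V →ₗ[k] V) : Prop :=
  ∀ v : V, ∃ N : ℕ, (∀ m : ℕ, N ≤ m → endPow (h ∘ₗ δ) m v = 0) ∧
    S v = ∑ i ∈ Finset.range N, (δ ∘ₗ endPow (h ∘ₗ δ) i) v

/-! ## Chain complexes over a field (graded by `ℤ`) -/

/-- A chain complex of `k`-vector spaces, realised internally to a single
carrier `V`: a `ℤ`-grading together with a square-zero differential of
degree `-1`. -/
structure ZCC (k V : Type*) [Field k] [AddCommGroup V] [Module k V] where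
  gr : VGrading k V ℤ
  d : V →ₗ[k] V
  d_sq : d ∘ₗ d = 0
  d_deg : ∀ n : ℤ, ∀ v ∈ gr.piece n, d v ∈ gr.piece (n - 1)

namespace ZCC

variable {k V : Type*} [Field k] [AddCommGroup V] [Module k V]

/-- `n`-cycles. -/
def cycles (C : ZCC k V) (n : ℤ) : Submodule k V := C.gr.piece n ⊓ LinearMap.ker C.d

/-- `n`-boundaries. -/
def bdries (C : ZCC k V) (n : ℤ) : Submodule k V := (C.gr.piece (n + 1)).map C.d

/-- The `n`-th homology `ker d_n / im d_{n+1}`. -/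
abbrev homology (C : ZCC k V) (n : ℤ) :=
  ↥(C.cycles n) ⧸ Submodule.comap (C.cycles n).subtype (C.bdries n)

/-- A chain complex is bounded if only finitely many chain groups are nonzero. -/
def Bounded (C : ZCC k V) : Prop := {n : ℤ | C.gr.proj n ≠ 0}.Finite

end ZCC

/-- A map between `ℤ`-graded spaces has degree `r`. -/
def HasDeg {k V W : Type*} [Field k] [AddCommGroup V] [Module k V]
    [AddCommGroup W] [Module k W]
    (GV : VGrading k V ℤ) (GW : VGrading k W ℤ) (f : V →ₗ[k] W) (r : ℤ) : Prop :=
  ∀ n : ℤ, ∀ v ∈ GV.piece n, f v ∈ GW.piece (n + r)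

/-! ## Based complexes and algebraic Morse theory -/

/-- A based complex: a chain complex whose chain groups are further decomposed
as direct sums indexed by `ι`; `deg : ι → ℤ` records which chain group each
basis index belongs to.  Components of the differential can only drop the
degree by one. -/
structure BasedComplex (k V ι : Type*) [Field k] [AddCommGroup V] [Module k V] where
  gr : VGrading k V ι
  deg : ι → ℤ
  d : V →ₗ[k] V
  d_sq : d ∘ₗ d = 0
  d_comp_deg : ∀ α β : ι, deg β ≠ deg α - 1 → gr.proj β ∘ₗ (d ∘ₗ gr.proj α) = 0

namespace BasedComplex

variable {k V ι : Type*} [Field k] [AddCommGroup V] [Module k V]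

/-- The component `d^{βα} : K^α → K^β` of the differential (as an endomorphism
of the carrier). -/
def dcomp (K : BasedComplex k V ι) (β α : ι) : V →ₗ[k] V :=
  K.gr.proj β ∘ₗ (K.d ∘ₗ K.gr.proj α)

/-- The digraph `G_K`: there is an edge `α → β` whenever `d^{βα} ≠ 0`. -/
def Edge (K : BasedComplex k V ι) (α β : ι) : Prop := K.dcomp β α ≠ 0

/-- The component `d^{βα}` restricts to an isomorphism `K^α → K^β`. -/
def CompIso (K : BasedComplex k V ι) (α β : ι) : Prop :=
  (∀ v ∈ K.gr.piece α, K.dcomp β α v = 0 → v = 0) ∧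
  (K.gr.piece α).map (K.dcomp β α) = K.gr.piece β

/-- The edge relation of the digraph `G^μ_K` obtained from `G_K` by reversing
exactly the edges in `μ`. -/
def MuEdge (K : BasedComplex k V ι) (μ : Set (ι × ι)) (α β : ι) : Prop :=
  (K.Edge α β ∧ (α, β) ∉ μ) ∨ (β, α) ∈ μ

/-- A partial matching on `G_K`: a set of edges, no two of which share a
vertex. -/
def IsPartialMatching (K : BasedComplex k V ι) (μ : Set (ι × ι)) : Prop :=
  (∀ e ∈ μ, K.Edge e.1 e.2) ∧
  ∀ e ∈ μ, ∀ e' ∈ μ, e ≠ e' → e.1 ≠ e'.1 ∧ e.1 ≠ e'.2 ∧ e.2 ≠ e'.1 ∧ e.2 ≠ e'.2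

/-- A Morse matching: a partial matching all of whose matched components are
isomorphisms, together with a well-founded (strict) partial order on each
`I_n` such that any path `α → γ → β` in `G^μ_K` between indices of the same
degree satisfies `β ≺ α`. -/
def IsMorseMatching (K : BasedComplex k V ι) (μ : Set (ι × ι)) : Prop :=
  K.IsPartialMatching μ ∧ (∀ e ∈ μ, K.CompIso e.1 e.2) ∧
  ∃ r : ι → ι → Prop, (∀ a b, r a b → K.deg a = K.deg b) ∧ Transitive r ∧
    WellFounded r ∧
    ∀ α γ β : ι, K.deg β = K.deg α → K.MuEdge μ α γ → K.MuEdge μ γ β → r β α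

/-- A vertex is critical for the matching `μ` if it is incident to no edge
of `μ`. -/
def IsCritical (μ : Set (ι × ι)) (α : ι) : Prop := ∀ e ∈ μ, e.1 ≠ α ∧ e.2 ≠ α

/-- The map `d̃`: the sum of the matched components of the differential. -/
noncomputable def dtilde (K : BasedComplex k V ι) (μ : Set (ι × ι)) : V →ₗ[k] V :=
  ∑ᶠ (e : ι × ι) (_ : e ∈ μ), K.dcomp e.2 e.1

/-- The projection onto the span of the critical pieces. -/
noncomputable def critProj (K : BasedComplex k V ι) (μ : Set (ι × ι)) : V →ₗ[k] V :=
  ∑ᶠ (α : ι) (_ : IsCritical μ α), K.gr.proj α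

/-- The span of the critical pieces, i.e. the chain groups of the Morse
complex `K^{(μ)}`. -/
def critSub (K : BasedComplex k V ι) (μ : Set (ι × ι)) : Submodule k V :=
  ⨆ (α : ι) (_ : IsCritical μ α), K.gr.piece α

/-- `ht` is the map `h̃` associated to the matching: it vanishes on every
piece which is not the target of a matched edge, and on the piece `K^β` with
`(α → β) ∈ μ` it is minus the inverse of `d^{βα}`. -/
def IsHTildeB (K : BasedComplex k V ι) (μ : Set (ι × ι)) (ht : V →ₗ[k] V) : Prop :=
  (∀ c : ι, (¬ ∃ a : ι, (a, c) ∈ μ) → ht ∘ₗ K.gr.proj c = 0) ∧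
  ∀ a b : ι, (a, b) ∈ μ → ∀ v ∈ K.gr.piece b,
    ht v ∈ K.gr.piece a ∧ K.dcomp b a (ht v) = -v

end BasedComplex

/-! ## `P`-graded chain complexes -/

/-- A `P`-graded chain complex: the carrier is graded by `ℤ × P`
(chain degree and poset grade), the differential is square-zero, drops the
chain degree by one and is `P`-filtered: components from grade `q` to grade
`p` vanish unless `p ≤ q`. -/
structure PCC (k V P : Type*) [Field k] [AddCommGroup V] [Module k V]
    [PartialOrder P] where
  gr : VGrading k V (ℤ × P)
  d : V →ₗ[k] V
  d_sq : d ∘ₗ d = 0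
  d_filt : ∀ (n m : ℤ) (p q : P),
    (m = n - 1 ∧ p ≤ q) ∨ gr.proj (m, p) ∘ₗ (d ∘ₗ gr.proj (n, q)) = 0

namespace PCC

variable {k V P : Type*} [Field k] [AddCommGroup V] [Module k V] [PartialOrder P]

/-- The twisted differential `t^{pq}_n : C^q_n → C^p_{n-1}`
(as an endomorphism of the carrier). -/
def tcomp (C : PCC k V P) (n : ℤ) (p q : P) : V →ₗ[k] V :=
  C.gr.proj (n - 1, p) ∘ₗ (C.d ∘ₗ C.gr.proj (n, q))

/-- Only finitely many chain groups are nonzero. -/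
def Bounded (C : PCC k V P) : Prop := {i : ℤ × P | C.gr.proj i ≠ 0}.Finite

/-- Cycles of the relative chain complex `(C^p, t^p)` in degree `n`. -/
def relCycles (C : PCC k V P) (n : ℤ) (p : P) : Submodule k V :=
  LinearMap.range (C.gr.proj (n, p)) ⊓ LinearMap.ker (C.tcomp n p p)

/-- Boundaries of the relative chain complex `(C^p, t^p)` in degree `n`. -/
def relBdries (C : PCC k V P) (n : ℤ) (p : P) : Submodule k V :=
  LinearMap.range (C.tcomp (n + 1) p p)

/-- The relative homology `H_n(C^p, t^p)`. -/
abbrev relHomology (C : PCC k V P) (n : ℤ) (p : P) :=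
  ↥(C.relCycles n p) ⧸ Submodule.comap (C.relCycles n p).subtype (C.relBdries n p)

/-- The diagonal part `d̃ = Σ_p t^p` of the differential. -/
noncomputable def dtilde (C : PCC k V P) : V →ₗ[k] V :=
  ∑ᶠ i : ℤ × P, C.gr.proj (i.1 - 1, i.2) ∘ₗ (C.d ∘ₗ C.gr.proj i)

/-- The strictly off-diagonal part `δ = Σ_{p < q} t^{pq} = d - d̃` of the
differential. -/
noncomputable def delta (C : PCC k V P) : V →ₗ[k] V := C.d - C.dtilde

/-- The sublevel subcomplex `F^p = ⊕_{q ≤ p} C^q`. -/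
def Fle (C : PCC k V P) (p : P) : Submodule k V :=
  ⨆ (i : ℤ × P) (_ : i.2 ≤ p), LinearMap.range (C.gr.proj i)

/-- The strict sublevel subcomplex `F^p̌ = ⊕_{q < p} C^q`. -/
def Flt (C : PCC k V P) (p : P) : Submodule k V :=
  ⨆ (i : ℤ × P) (_ : i.2 < p), LinearMap.range (C.gr.proj i)

/-- The total relative chain group `C^p = ⊕_n C^p_n` at grade `p`. -/
def Cp (C : PCC k V P) (p : P) : Submodule k V :=
  ⨆ n : ℤ, LinearMap.range (C.gr.proj (n, p))

end PCC

/-- A linear map between `(ℤ × P)`-graded spaces is `P`-filtered: its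
components from grade `q` to grade `p` vanish unless `p ≤ q`. -/
def PFilt {k V W P : Type*} [Field k] [AddCommGroup V] [Module k V]
    [AddCommGroup W] [Module k W] [PartialOrder P]
    (GV : VGrading k V (ℤ × P)) (GW : VGrading k W (ℤ × P)) (f : V →ₗ[k] W) : Prop :=
  ∀ (n m : ℤ) (p q : P), ¬ p ≤ q → GW.proj (m, p) ∘ₗ (f ∘ₗ GV.proj (n, q)) = 0

/-- A linear map between `(ℤ × P)`-graded spaces has chain degree `r`. -/
def HasDegZP {k V W P : Type*} [Field k] [AddCommGroup V] [Module k V]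
    [AddCommGroup W] [Module k W] [PartialOrder P]
    (GV : VGrading k V (ℤ × P)) (GW : VGrading k W (ℤ × P)) (f : V →ₗ[k] W)
    (r : ℤ) : Prop :=
  ∀ (n m : ℤ) (p q : P), m ≠ n + r → GW.proj (m, q) ∘ₗ (f ∘ₗ GV.proj (n, p)) = 0

/-- A linear map between `P`-graded spaces is `P`-filtered. -/
def PFilt0 {k V W P : Type*} [Field k] [AddCommGroup V] [Module k V]
    [AddCommGroup W] [Module k W] [PartialOrder P]
    (GW : VGrading k W P) (GV : VGrading k V P) (f : V →ₗ[k] W) : Prop :=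
  ∀ p q : P, ¬ p ≤ q → GW.proj p ∘ₗ (f ∘ₗ GV.proj q) = 0

/-! ## Consistent splittings -/

/-- A consistent splitting of a `P`-graded chain complex: each relative chain
group `C^p_n` is split as an internal direct sum `M^p_n ⊕ B^p_n ⊕ K^p_n`
(recorded by three orthogonal idempotents summing to the grading projection),
where the `B`-summand is the space of relative boundaries `im(t^p_{n+1})`,
the `M`- and `B`-summands together span the relative cycles `ker(t^p_n)`,
and `t^p_n` maps the `K`-summand isomorphically onto `B^p_{n-1}`. -/
structure ConsSplit {k V P : Type*} [Field k] [AddCommGroup V] [Module k V]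
    [PartialOrder P] (C : PCC k V P) where
  piM : ℤ → P → (V →ₗ[k] V)
  piB : ℤ → P → (V →ₗ[k] V)
  piK : ℤ → P → (V →ₗ[k] V)
  sum_eq : ∀ n p, piM n p + piB n p + piK n p = C.gr.proj (n, p)
  idem_M : ∀ n p, piM n p ∘ₗ piM n p = piM n p
  idem_B : ∀ n p, piB n p ∘ₗ piB n p = piB n p
  idem_K : ∀ n p, piK n p ∘ₗ piK n p = piK n p
  orth_MB : ∀ n p, piM n p ∘ₗ piB n p = 0
  orth_BM : ∀ n p, piB n p ∘ₗ piM n p = 0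
  orth_MK : ∀ n p, piM n p ∘ₗ piK n p = 0
  orth_KM : ∀ n p, piK n p ∘ₗ piM n p = 0
  orth_BK : ∀ n p, piB n p ∘ₗ piK n p = 0
  orth_KB : ∀ n p, piK n p ∘ₗ piB n p = 0
  range_B : ∀ n p, LinearMap.range (piB n p) = LinearMap.range (C.tcomp (n + 1) p p)
  ker_split : ∀ n p, LinearMap.range (piM n p) ⊔ LinearMap.range (piB n p)
      = LinearMap.range (C.gr.proj (n, p)) ⊓ LinearMap.ker (C.tcomp n p p)
  K_inj : ∀ n p, ∀ v ∈ LinearMap.range (piK n p), C.tcomp n p p v = 0 → v = 0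
  K_onto : ∀ n p, (LinearMap.range (piK n p)).map (C.tcomp n p p)
      = LinearMap.range (piB (n - 1) p)

namespace ConsSplit

variable {k V P : Type*} [Field k] [AddCommGroup V] [Module k V] [PartialOrder P]
  {C : PCC k V P}

/-- The projection `j_M` onto the total Morse summand `M = ⊕_{n,p} M^p_n`. -/
noncomputable def projM (sp : ConsSplit C) : V →ₗ[k] V := ∑ᶠ i : ℤ × P, sp.piM i.1 i.2

/-- The projection `j_K` onto the total preboundary summand. -/
noncomputable def projK (sp : ConsSplit C) : V →ₗ[k] V := ∑ᶠ i : ℤ × P, sp.piK i.1 i.2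

/-- The total Morse summand `M = ⊕_{n,p} M^p_n` as a submodule; this is the
underlying space of the Conley (Morse) complex. -/
def Msub (sp : ConsSplit C) : Submodule k V := ⨆ i : ℤ × P, LinearMap.range (sp.piM i.1 i.2)

/-- The differential `d̃ = i_B ∘ (⊕_p t^p|_{K^p}) ∘ j_K`. -/
noncomputable def dtildeK (sp : ConsSplit C) : V →ₗ[k] V :=
  ∑ᶠ i : ℤ × P, C.tcomp i.1 i.2 i.2 ∘ₗ sp.piK i.1 i.2

/-- `ht` is the map `h̃ = -i_K ∘ (⊕_p (t^p|_{K^p})^{-1}) ∘ j_B`: it vanishes on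
the `M`- and `K`-summands, and on each `B^p_n` it is minus the inverse of the
isomorphism `t^p_{n+1} : K^p_{n+1} → B^p_n`. -/
def IsHTilde (sp : ConsSplit C) (ht : V →ₗ[k] V) : Prop :=
  (∀ n p, ht ∘ₗ sp.piM n p = 0) ∧ (∀ n p, ht ∘ₗ sp.piK n p = 0) ∧
  ∀ n p, ∀ v ∈ LinearMap.range (sp.piB n p),
    ht v ∈ LinearMap.range (sp.piK (n + 1) p) ∧ C.tcomp (n + 1) p p (ht v) = -v

end ConsSplit

/-! ## Ordered bases, pivots and separating bases -/

/-- `i` is the pivot index of `v` with respect to the coordinate functions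
`coord`: the largest index at which `v` has a nonzero coefficient. -/
def IsPivot {k V : Type*} [Field k] [AddCommGroup V] [Module k V] {m : ℕ}
    (coord : Fin m → V →ₗ[k] k) (v : V) (i : Fin m) : Prop :=
  coord i v ≠ 0 ∧ ∀ j : Fin m, coord j v ≠ 0 → j ≤ i

/-- `A n` is a totally ordered (by the order of `Fin (m n)`) basis of the
`n`-th chain group, with coordinate functionals `coord n`. -/
def IsOrderedBasisData {k V : Type*} [Field k] [AddCommGroup V] [Module k V]
    (C : ZCC k V) (m : ℤ → ℕ) (A : ∀ n : ℤ, Fin (m n) → V)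
    (coord : ∀ n : ℤ, Fin (m n) → V →ₗ[k] k) : Prop :=
  ∀ n : ℤ, (∀ i, A n i ∈ C.gr.piece n) ∧ LinearIndependent k (A n) ∧
    Submodule.span k (Set.range (A n)) = C.gr.piece n ∧
    ∀ v ∈ C.gr.piece n, v = ∑ i : Fin (m n), coord n i v • A n i

/-- `(H, B, Pp)` is a family of separating bases: for each `n`, the triple
`(H n, B n, Pp n)` is a separating basis for the `n`-th chain group with
respect to the ordered basis `A n`. -/
def IsSepSystem {k V : Type*} [Field k] [AddCommGroup V] [Module k V]
    (C : ZCC k V) (m : ℤ → ℕ) (A : ∀ n : ℤ, Fin (m n) → V)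
    (coord : ∀ n : ℤ, Fin (m n) → V →ₗ[k] k) (H B Pp : ℤ → Set V) : Prop :=
  ∀ n : ℤ,
    (H n ⊆ C.gr.piece n) ∧ (B n ⊆ C.gr.piece n) ∧ (Pp n ⊆ C.gr.piece n) ∧
    (H n).Finite ∧ (B n).Finite ∧ (Pp n).Finite ∧
    LinearIndependent k (fun x : ↥(H n) => (x : V)) ∧
    LinearIndependent k (fun x : ↥(B n) => (x : V)) ∧
    LinearIndependent k (fun x : ↥(Pp n) => (x : V)) ∧
    Disjoint (Submodule.span k (H n)) (Submodule.span k (B n)) ∧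
    Disjoint (Submodule.span k (H n) ⊔ Submodule.span k (B n))
      (Submodule.span k (Pp n)) ∧
    (Submodule.span k (H n) ⊔ Submodule.span k (B n) ⊔ Submodule.span k (Pp n)
      = C.gr.piece n) ∧
    Submodule.span k (B n) = C.bdries n ∧
    (Submodule.span k (H n) ⊔ Submodule.span k (B n) = C.cycles n) ∧
    (∀ v ∈ Pp n, C.d v ∈ B (n - 1)) ∧
    (∀ v ∈ H n ∪ Pp n, ∀ b ∈ B n, ∀ i, IsPivot (coord n) b i → coord n i v = 0) ∧
    (∀ z ∈ H n, ∀ i, IsPivot (coord n) z i →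
      ∀ v, ((v ∈ H n ∧ v ≠ z) ∨ v ∈ Pp n) → coord n i v = 0) ∧
    (∀ z ∈ H n, ∀ i, IsPivot (coord n) z i → coord n i z = 1)

/-- The set of basis vectors which are pivots of elements of `H`. -/
def pivotVecs {k V : Type*} [Field k] [AddCommGroup V] [Module k V] {mm : ℕ}
    (coord : Fin mm → V →ₗ[k] k) (A : Fin mm → V) (H : Set V) : Set V :=
  {w : V | ∃ z ∈ H, ∃ i : Fin mm, IsPivot coord z i ∧ w = A i}
/-! ## Auxiliary results -/

namespace VGrading

variable {k V ι : Type*} [Field k] [AddCommGroup V] [Module k V]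

lemma proj_apply_of_mem (G : VGrading k V ι) {i : ι} {v : V} (hv : v ∈ G.piece i) :
    G.proj i v = v := by
  obtain ⟨w, rfl⟩ := hv
  exact LinearMap.congr_fun (G.proj_idem i) w

lemma proj_apply_of_mem_of_ne (G : VGrading k V ι) {i j : ι} (hij : i ≠ j) {v : V}
    (hv : v ∈ G.piece j) : G.proj i v = 0 := by
  obtain ⟨w, rfl⟩ := hv
  exact LinearMap.congr_fun (G.proj_orth i j hij) w

/-- Linear maps agreeing on every piece of a finite grading are equal. -/
lemma linearMap_ext [Finite ι] (G : VGrading k V ι) {W : Type*} [AddCommGroup W] [Module k W]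
    {f g : V →ₗ[k] W} (h : ∀ i, ∀ v ∈ G.piece i, f v = g v) : f = g := by
  have := Fintype.ofFinite ι
  ext v
  rw [← G.proj_total v, finsum_eq_sum_of_fintype, map_sum, map_sum]
  exact Finset.sum_congr rfl fun i _ => h i _ ⟨v, rfl⟩

end VGrading

lemma endPow_succ_apply {k V : Type*} [Field k] [AddCommGroup V] [Module k V]
    (f : V →ₗ[k] V) (n : ℕ) (v : V) : endPow f (n + 1) v = endPow f n (f v) := by
  induction n with
  | zero => rfl
  | succ n ih => exact congrArg f ih

namespace IsPerturbSum

variable {k V : Type*} [Field k] [AddCommGroup V] [Module k V] {δ h S : V →ₗ[k] V}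

lemma exists_forall_ge (hS : IsPerturbSum δ h S) (v : V) :
    ∃ N, ∀ M, N ≤ M → S v = ∑ i ∈ Finset.range M, δ (endPow (h ∘ₗ δ) i v) := by
  obtain ⟨N, hN, hv⟩ := hS v
  refine ⟨N, fun M hM => hv.trans (Finset.sum_subset (by simpa using hM) fun i _ hi => ?_)⟩
  simp [hN i (by simpa using hi)]

lemma eq_add_left (hS : IsPerturbSum δ h S) : S = δ + δ ∘ₗ h ∘ₗ S := by
  ext v
  obtain ⟨N, hN⟩ := hS.exists_forall_ge v
  have h₁ := hN (N + 1) N.le_succ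
  rw [Finset.sum_range_succ'] at h₁
  simp only [LinearMap.add_apply, LinearMap.comp_apply]
  conv_lhs => rw [h₁]
  rw [hN N le_rfl, map_sum, map_sum, add_comm]
  rfl

lemma eq_add_right (hS : IsPerturbSum δ h S) : S = δ + S ∘ₗ h ∘ₗ δ := by
  ext v
  obtain ⟨N, hN⟩ := hS.exists_forall_ge v
  obtain ⟨M, hM⟩ := hS.exists_forall_ge (h (δ v))
  simp only [LinearMap.add_apply, LinearMap.comp_apply]
  rw [hN (max N M + 1) (by omega), hM (max N M) (by omega), Finset.sum_range_succ', add_comm]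
  simp only [endPow_succ_apply]
  rfl

end IsPerturbSum

section Ring

variable {R : Type*} [Ring R] {a x h p s : R}

lemma perturbation_cocycle (ha : a * a = 0) (hd : (a + x) * (a + x) = 0)
    (hp : p = 1 + a * h + h * a) (hl : s = x + x * h * s) (hr : s = x + s * h * x) :
    a * s + s * a + s * p * s = 0 := by
  have h₁ : (1 + s * h) * (1 - x * h) = 1 := by
    linear_combination (norm := noncomm_ring) hr * h
  have h₂ : (1 - h * x) * (1 + h * s) = 1 := by
    linear_combination (norm := noncomm_ring) h * hl
  have h₃ : (1 - x * h) * s = x := by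
    linear_combination (norm := noncomm_ring) hl
  have h₄ : s * (1 - h * x) = x := by
    linear_combination (norm := noncomm_ring) hr
  have h₅ : (1 - x * h) * (a * s + s * a + s * p * s) * (1 - h * x) = 0 := by
    calc _ = (1 - x * h) * a * (s * (1 - h * x)) + (1 - x * h) * s * a * (1 - h * x)
          + (1 - x * h) * s * p * (s * (1 - h * x)) := by noncomm_ring
      _ = (a + x) * (a + x) - a * a := by rw [h₃, h₄, hp]; noncomm_ring
      _ = 0 := by rw [hd, ha, sub_zero]
  calc _ = (1 + s * h) * (1 - x * h) * (a * s + s * a + s * p * s)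
        * ((1 - h * x) * (1 + h * s)) := by rw [h₁, h₂, one_mul, mul_one]
    _ = (1 + s * h) * ((1 - x * h) * (a * s + s * a + s * p * s) * (1 - h * x))
        * (1 + h * s) := by noncomm_ring
    _ = 0 := by rw [h₅, mul_zero, zero_mul]

lemma perturbation_f_chain (hp : p = 1 + a * h + h * a) (hpa : p * a = 0)
    (hc : a * s + s * a + s * p * s = 0) (hr : s = x + s * h * x) :
    (p + p * (s * h)) * (a + x) = p * s * (p + p * (s * h)) := by
  have h₁ : p * s * p = p * s + p * s * (a * h) + p * s * (h * a) := by
    rw [mul_assoc p s, hp]; noncomm_ring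
  linear_combination (norm := noncomm_ring) hpa - p * hr - h₁ - p * hc * h + hpa * s * h

lemma perturbation_g_chain (hp : p = 1 + a * h + h * a) (hap : a * p = 0)
    (hc : a * s + s * a + s * p * s = 0) (hl : s = x + x * h * s) :
    (1 + h * s) * p * s * p = (a + x) * (1 + h * s) * p := by
  have h₁ : p * s * p = s * p + a * h * s * p + h * a * s * p := by
    rw [mul_assoc p s]
    nth_rw 1 [hp]
    noncomm_ring
  linear_combination (norm := noncomm_ring) -hap + hl * p + h₁ + h * hc * p - h * s * hap

lemma perturbation_homotopy (hp : p = 1 + a * h + h * a)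
    (hc : a * s + s * a + s * p * s = 0) (hl : s = x + x * h * s) (hr : s = x + s * h * x) :
    (1 + h * s) * (p + p * (s * h))
      = 1 + (a + x) * (h + h * (s * h)) + (h + h * (s * h)) * (a + x) := by
  have h₁ : p * s * h = s * h + a * h * s * h + h * a * s * h := by rw [hp]; noncomm_ring
  have h₂ : h * s * p = h * s + h * s * a * h + h * s * h * a := by rw [hp]; noncomm_ring
  linear_combination (norm := noncomm_ring) hp + h₁ + h₂ + h * hc * h + hl * h + h * hr

end Ring

namespace BasedComplex

variable {k V ι : Type*} [Field k] [AddCommGroup V] [Module k V]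
  {K : BasedComplex k V ι} {μ : Set (ι × ι)} {a b c : ι} {v : V}

lemma dcomp_mem (K : BasedComplex k V ι) (b a : ι) (v : V) : K.dcomp b a v ∈ K.gr.piece b :=
  ⟨_, rfl⟩

lemma dcomp_apply_of_mem_of_ne (hac : a ≠ c) (hv : v ∈ K.gr.piece c) : K.dcomp b a v = 0 := by
  simp [dcomp, K.gr.proj_apply_of_mem_of_ne hac hv]

namespace IsPartialMatching

lemma fst_ne_snd (hμ : K.IsPartialMatching μ) {e e' : ι × ι} (he : e ∈ μ) (he' : e' ∈ μ) :
    e.1 ≠ e'.2 := by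
  by_cases h : e = e'
  · subst h
    intro h
    have hdeg : K.deg e.2 = K.deg e.1 - 1 := by
      by_contra hne
      exact hμ.1 e he (K.d_comp_deg _ _ hne)
    rw [h] at hdeg
    omega
  · exact (hμ.2 _ he _ he' h).2.1

end IsPartialMatching

/-- A vertex is critical, the source of a matched edge, or the target of a matched edge. -/
lemma critical_or_matched (μ : Set (ι × ι)) (c : ι) :
    IsCritical μ c ∨ (∃ b, (c, b) ∈ μ) ∨ ∃ a, (a, c) ∈ μ := by
  by_cases h : IsCritical μ c
  · exact Or.inl h
  · right
    simp only [IsCritical, not_forall] at h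
    obtain ⟨⟨a, b⟩, he, hab⟩ := h
    by_cases ha : a = c
    · exact Or.inl ⟨b, ha ▸ he⟩
    · exact Or.inr ⟨a, by_contra fun hb => hab ⟨ha, fun h => hb (h ▸ he)⟩⟩

lemma IsHTildeB.apply_of_not_target {ht : V →ₗ[k] V} (hht : K.IsHTildeB μ ht)
    (hc : ¬ ∃ a, (a, c) ∈ μ) (hv : v ∈ K.gr.piece c) : ht v = 0 := by
  have := LinearMap.congr_fun (hht.1 c hc) v
  rwa [LinearMap.comp_apply, K.gr.proj_apply_of_mem hv] at this

section Finite

variable [Finite ι]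

lemma dtilde_apply (K : BasedComplex k V ι) (μ : Set (ι × ι)) (v : V) :
    K.dtilde μ v = ∑ᶠ (e : ι × ι) (_ : e ∈ μ), K.dcomp e.2 e.1 v := by
  classical
  have := Fintype.ofFinite ι
  simp only [dtilde, finsum_eq_if, finsum_eq_sum_of_fintype, LinearMap.sum_apply]
  exact Finset.sum_congr rfl fun e _ => by split_ifs <;> rfl

lemma dtilde_apply_of_not_source (hc : ∀ b, (c, b) ∉ μ) (hv : v ∈ K.gr.piece c) :
    K.dtilde μ v = 0 := by
  rw [dtilde_apply]
  refine finsum_mem_eq_zero_of_forall_eq_zero fun e he => dcomp_apply_of_mem_of_ne ?_ hv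
  rintro rfl
  exact hc _ he

lemma dtilde_apply_of_mem (hμ : K.IsPartialMatching μ) (he : (c, b) ∈ μ)
    (hv : v ∈ K.gr.piece c) : K.dtilde μ v = K.dcomp b c v := by
  classical
  have := Fintype.ofFinite ι
  rw [dtilde_apply]
  simp only [finsum_eq_if, finsum_eq_sum_of_fintype]
  rw [Finset.sum_eq_single (c, b) (fun e _ hne => ?_) (by simp), if_pos he]
  split_ifs with he'
  · exact dcomp_apply_of_mem_of_ne (hμ.2 _ he' _ he hne).1 hv
  · rfl

lemma critProj_apply (K : BasedComplex k V ι) (μ : Set (ι × ι)) (v : V) :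
    K.critProj μ v = ∑ᶠ (c : ι) (_ : IsCritical μ c), K.gr.proj c v := by
  classical
  have := Fintype.ofFinite ι
  simp only [critProj, finsum_eq_if, finsum_eq_sum_of_fintype, LinearMap.sum_apply]
  exact Finset.sum_congr rfl fun e _ => by split_ifs <;> rfl

lemma critProj_apply_of_critical (hc : IsCritical μ c) (hv : v ∈ K.gr.piece c) :
    K.critProj μ v = v := by
  classical
  have := Fintype.ofFinite ι
  rw [critProj_apply]
  simp only [finsum_eq_if, finsum_eq_sum_of_fintype]
  rw [Finset.sum_eq_single c (fun e _ hne => ?_) (by simp), if_pos hc,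
    K.gr.proj_apply_of_mem hv]
  simp [K.gr.proj_apply_of_mem_of_ne hne hv]

lemma critProj_apply_of_not_critical (hc : ¬ IsCritical μ c) (hv : v ∈ K.gr.piece c) :
    K.critProj μ v = 0 := by
  rw [critProj_apply]
  refine finsum_mem_eq_zero_of_forall_eq_zero (s := {c | IsCritical μ c}) fun e he =>
    K.gr.proj_apply_of_mem_of_ne ?_ hv
  rintro rfl
  exact hc he

lemma critProj_mem (K : BasedComplex k V ι) (μ : Set (ι × ι)) (v : V) :
    K.critProj μ v ∈ K.critSub μ := by
  classical
  have := Fintype.ofFinite ι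
  rw [critProj_apply]
  simp only [finsum_eq_if, finsum_eq_sum_of_fintype]
  refine Submodule.sum_mem _ fun c _ => ?_
  split_ifs with hc
  · exact Submodule.mem_iSup_of_mem c (Submodule.mem_iSup_of_mem hc ⟨v, rfl⟩)
  · exact Submodule.zero_mem _

lemma critProj_apply_of_mem_critSub (hv : v ∈ K.critSub μ) : K.critProj μ v = v := by
  have : K.critSub μ ≤ LinearMap.eqLocus (K.critProj μ) LinearMap.id :=
    iSup₂_le fun c hc w hw => critProj_apply_of_critical hc hw
  exact this hv

section Identities

variable {ht : V →ₗ[k] V}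

lemma dtilde_comp_dtilde (hμ : K.IsPartialMatching μ) : K.dtilde μ ∘ₗ K.dtilde μ = 0 := by
  refine K.gr.linearMap_ext fun c v hv => ?_
  by_cases hs : ∃ b, (c, b) ∈ μ
  · obtain ⟨b, hb⟩ := hs
    rw [LinearMap.comp_apply, dtilde_apply_of_mem hμ hb hv]
    exact dtilde_apply_of_not_source (fun e he => hμ.fst_ne_snd he hb rfl) (K.dcomp_mem b c v)
  · rw [LinearMap.comp_apply, dtilde_apply_of_not_source (not_exists.1 hs) hv, map_zero]
    rfl

lemma critProj_comp_dtilde (hμ : K.IsPartialMatching μ) : K.critProj μ ∘ₗ K.dtilde μ = 0 := by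
  refine K.gr.linearMap_ext fun c v hv => ?_
  by_cases hs : ∃ b, (c, b) ∈ μ
  · obtain ⟨b, hb⟩ := hs
    rw [LinearMap.comp_apply, dtilde_apply_of_mem hμ hb hv]
    exact critProj_apply_of_not_critical (fun h => (h _ hb).2 rfl) (K.dcomp_mem b c v)
  · rw [LinearMap.comp_apply, dtilde_apply_of_not_source (not_exists.1 hs) hv, map_zero]
    rfl

lemma dtilde_comp_critProj (K : BasedComplex k V ι) (μ : Set (ι × ι)) :
    K.dtilde μ ∘ₗ K.critProj μ = 0 := by
  refine K.gr.linearMap_ext fun c v hv => ?_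
  by_cases hc : IsCritical μ c
  · rw [LinearMap.comp_apply, critProj_apply_of_critical hc hv]
    exact dtilde_apply_of_not_source (fun b hb => (hc _ hb).1 rfl) hv
  · rw [LinearMap.comp_apply, critProj_apply_of_not_critical hc hv, map_zero]
    rfl

lemma critProj_comp_critProj (K : BasedComplex k V ι) (μ : Set (ι × ι)) :
    K.critProj μ ∘ₗ K.critProj μ = K.critProj μ :=
  LinearMap.ext fun v => critProj_apply_of_mem_critSub (K.critProj_mem μ v)

namespace IsHTildeB

lemma comp_critProj (hht : K.IsHTildeB μ ht) : ht ∘ₗ K.critProj μ = 0 := by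
  refine K.gr.linearMap_ext fun c v hv => ?_
  by_cases hc : IsCritical μ c
  · rw [LinearMap.comp_apply, critProj_apply_of_critical hc hv]
    exact hht.apply_of_not_target (fun ⟨a, ha⟩ => (hc _ ha).2 rfl) hv
  · rw [LinearMap.comp_apply, critProj_apply_of_not_critical hc hv, map_zero]
    rfl

lemma critProj_comp (hht : K.IsHTildeB μ ht) : K.critProj μ ∘ₗ ht = 0 := by
  refine K.gr.linearMap_ext fun c v hv => ?_
  by_cases hc : ∃ a, (a, c) ∈ μ
  · obtain ⟨a, ha⟩ := hc
    exact critProj_apply_of_not_critical (fun h => (h _ ha).1 rfl) (hht.2 a c ha v hv).1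
  · rw [LinearMap.comp_apply, hht.apply_of_not_target hc hv, map_zero]
    rfl

lemma comp_self (hht : K.IsHTildeB μ ht) (hμ : K.IsPartialMatching μ) : ht ∘ₗ ht = 0 := by
  refine K.gr.linearMap_ext fun c v hv => ?_
  by_cases hc : ∃ a, (a, c) ∈ μ
  · obtain ⟨a, ha⟩ := hc
    exact hht.apply_of_not_target (fun ⟨b, hb⟩ => hμ.fst_ne_snd ha hb rfl)
      (hht.2 a c ha v hv).1
  · rw [LinearMap.comp_apply, hht.apply_of_not_target hc hv, map_zero]
    rfl

lemma critProj_eq (hht : K.IsHTildeB μ ht) (hμ : K.IsPartialMatching μ)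
    (hiso : ∀ e ∈ μ, K.CompIso e.1 e.2) :
    K.critProj μ = LinearMap.id + K.dtilde μ ∘ₗ ht + ht ∘ₗ K.dtilde μ := by
  refine K.gr.linearMap_ext fun c v hv => ?_
  simp only [LinearMap.add_apply, LinearMap.comp_apply, LinearMap.id_apply]
  rcases critical_or_matched μ c with hc | ⟨b, hb⟩ | ⟨a, ha⟩
  · rw [critProj_apply_of_critical hc hv,
      hht.apply_of_not_target (fun ⟨a, ha⟩ => (hc _ ha).2 rfl) hv,
      dtilde_apply_of_not_source (fun b hb => (hc _ hb).1 rfl) hv]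
    simp
  · obtain ⟨hw, hdw⟩ := hht.2 c b hb _ (K.dcomp_mem b c v)
    have h := (hiso _ hb).1 (v + ht (K.dcomp b c v)) (add_mem hv hw) (by simp [hdw])
    rw [critProj_apply_of_not_critical (fun h => (h _ hb).1 rfl) hv,
      hht.apply_of_not_target (fun ⟨a, ha⟩ => hμ.fst_ne_snd hb ha rfl) hv,
      dtilde_apply_of_mem hμ hb hv, map_zero, add_zero, h]
  · obtain ⟨hw, hdw⟩ := hht.2 a c ha v hv
    rw [critProj_apply_of_not_critical (fun h => (h _ ha).2 rfl) hv,
      dtilde_apply_of_mem hμ ha hw, hdw,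
      dtilde_apply_of_not_source (fun b hb => hμ.fst_ne_snd hb ha rfl) hv]
    simp

end IsHTildeB

end Identities

end Finite

end BasedComplex

/-- Let `(K, d)` be a based complex with finite digraph
`G_K` and `μ` a Morse matching, with `d̃`, `δ = d - d̃`, `f̃`, `g̃`, `h̃` defined
from `μ` and `S = Σ_{n ≥ 0} δ (h̃δ)^n`.  Define `K^{(μ)}` to be the chain
complex whose chain groups are spanned by the critical pieces, with
differential `d^μ = f̃ S g̃`.  Then `(f, g, h)` with `f = f̃ + f̃Sh̃`,
`g = g̃ + h̃Sg̃` and `h = h̃ + h̃Sh̃` is a contraction from `(K, d)` onto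
`(K^{(μ)}, d^μ)`. -/
theorem stmt3 {k V ι : Type*} [Field k] [AddCommGroup V] [Module k V] [Finite ι]
    (K : BasedComplex k V ι) (μ : Set (ι × ι)) (hμ : K.IsMorseMatching μ)
    (ht : V →ₗ[k] V) (hht : K.IsHTildeB μ ht)
    (S : V →ₗ[k] V) (hS : IsPerturbSum (K.d - K.dtilde μ) ht S) :
    ∃ (f : V →ₗ[k] ↥(K.critSub μ)) (dM : ↥(K.critSub μ) →ₗ[k] ↥(K.critSub μ)),
      -- `f = f̃ + f̃Sh̃`  (where `f̃` is the corestriction of the critical projection)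
      (K.critSub μ).subtype ∘ₗ f = K.critProj μ + K.critProj μ ∘ₗ (S ∘ₗ ht) ∧
      -- `d^μ = f̃Sg̃`  (where `g̃` is the inclusion of the critical summand)
      (K.critSub μ).subtype ∘ₗ dM = K.critProj μ ∘ₗ (S ∘ₗ (K.critSub μ).subtype) ∧
      IsContraction K.d dM f
        ((K.critSub μ).subtype + ht ∘ₗ (S ∘ₗ (K.critSub μ).subtype))
        (ht + ht ∘ₗ (S ∘ₗ ht)) := by
  obtain ⟨hmatch, hiso, -⟩ := hμ
  set a : Module.End k V := K.dtilde μ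
  set p : Module.End k V := K.critProj μ
  obtain ⟨x, hx⟩ : ∃ x : Module.End k V, x = K.d - a := ⟨_, rfl⟩
  have hd : K.d = a + x := by rw [hx]; abel
  rw [← hx] at hS
  have haa : a * a = 0 := BasedComplex.dtilde_comp_dtilde hmatch
  have hpa : p * a = 0 := BasedComplex.critProj_comp_dtilde hmatch
  have hap : a * p = 0 := K.dtilde_comp_critProj μ
  have hpp : p * p = p := K.critProj_comp_critProj μ
  have hhp : ht * p = 0 := hht.comp_critProj
  have hph : p * ht = 0 := hht.critProj_comp
  have hhh : ht * ht = 0 := hht.comp_self hmatch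
  have hpe : p = 1 + a * ht + ht * a := hht.critProj_eq hmatch hiso
  have hl : S = x + x * ht * S := hS.eq_add_left
  have hr : S = x + S * ht * x := hS.eq_add_right
  have hc := perturbation_cocycle haa (hd ▸ K.d_sq) hpe hl hr
  have hmem : ∀ v, p v ∈ K.critSub μ := K.critProj_mem μ
  have hfix : ∀ w : K.critSub μ, p w = w := fun w => BasedComplex.critProj_apply_of_mem_critSub w.2
  refine ⟨LinearMap.codRestrict _ (p + p ∘ₗ (S ∘ₗ ht)) fun v => add_mem (hmem _) (hmem _),
    LinearMap.codRestrict _ (p ∘ₗ (S ∘ₗ (K.critSub μ).subtype)) fun v => hmem _,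
    LinearMap.ext fun _ => rfl, LinearMap.ext fun _ => rfl, ?_⟩
  rw [hd]
  constructor
  · ext v
    exact LinearMap.congr_fun (perturbation_f_chain hpe hpa hc hr) v
  · ext w
    have := LinearMap.congr_fun (perturbation_g_chain hpe hap hc hl) (w : V)
    simp only [Module.End.mul_apply, LinearMap.add_apply, Module.End.one_apply, hfix] at this
    exact this
  · ext w
    have h₁ : (p + p * (S * ht)) * (1 + ht * S) * p = p := by
      linear_combination (norm := noncomm_ring)
        hpp + hph * S * p + p * S * hhh * S * p + p * S * hhp
    have := LinearMap.congr_fun h₁ (w : V)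
    simp only [Module.End.mul_apply, LinearMap.add_apply, Module.End.one_apply, hfix] at this
    exact this
  · exact perturbation_homotopy hpe hc hl hr
  · ext v
    have h₁ : (p + p * (S * ht)) * (ht + ht * (S * ht)) = 0 := by
      linear_combination (norm := noncomm_ring)
        hph * (1 + S * ht) + p * S * hhh * (1 + S * ht)
    exact LinearMap.congr_fun h₁ v
  · ext w
    have h₁ : (ht + ht * (S * ht)) * (1 + ht * S) * p = 0 := by
      linear_combination (norm := noncomm_ring)
        (1 + ht * S) * hhh * S * p + (1 + ht * S) * hhp
    have := LinearMap.congr_fun h₁ (w : V)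
    simp only [Module.End.mul_apply, LinearMap.add_apply, Module.End.one_apply, hfix] at this
    exact this
  · have h₁ : (ht + ht * (S * ht)) * (ht + ht * (S * ht)) = 0 := by
      linear_combination (norm := noncomm_ring) (1 + ht * S) * hhh * (1 + S * ht)
    exact h₁
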